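/- arXiv:1209.4851 — 3 statements merged into one kernel-verified Lean document; each statement's English description precedes it below -/
import Mathlib

section
/- Every Banach-Saks subset of a Banach space is relatively weakly compact. -/
open Filter

/-- A subset `A` of a Banach space is a Banach-Saks set if every sequence in `A`
has a subsequence whose Cesàro means converge in norm. -/
def IsBanachSaksSet {X : Type*} [NormedAddCommGroup X] [NormedSpace ℝ X] (A : Set X) : Prop :=
  ∀ x : ℕ → X, (∀ n, x n ∈ A) → ∃ φ : ℕ → ℕ, StrictMono φ ∧ ∃ L : X,
    Tendsto (fun N : ℕ => (N : ℝ)⁻¹ • ∑ k ∈ Finset.range N, x (φ k)) atTop (nhds L)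

lemma bs_isBounded {X : Type*} [NormedAddCommGroup X] [NormedSpace ℝ X] (A : Set X)
    (hA : IsBanachSaksSet A) : Bornology.IsBounded A := by
  by_contra hb
  have h1 : ∀ n : ℕ, ∃ x ∈ A, (n : ℝ) + 1 ≤ ‖x‖ := by
    intro n
    by_contra! hn
    exact hb (isBounded_iff_forall_norm_le.2 ⟨(n : ℝ) + 1, fun x hx => (hn x hx).le⟩)
  choose x hxA hx using h1
  obtain ⟨φ, hφ, L, hL⟩ := hA x hxA
  have h2 := hL.comp (tendsto_add_atTop_nat 1)
  have h3 : Tendsto (fun N : ℕ => (N : ℝ) / ((N : ℝ) + 1)) atTop (nhds 1) :=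
    tendsto_natCast_div_add_atTop 1
  have h4 := (h2.sub (h3.smul hL)).norm
  have h5 : ‖L - (1 : ℝ) • L‖ < 1 := by simp
  obtain ⟨N, hN, hN0⟩ := ((h4.eventually (gt_mem_nhds h5)).and (eventually_gt_atTop 0)).exists
  have hN1 : (0 : ℝ) < N := by exact_mod_cast hN0
  have h6 : (((N + 1 : ℕ) : ℝ)⁻¹ • ∑ k ∈ Finset.range (N + 1), x (φ k))
      - ((N : ℝ) / ((N : ℝ) + 1)) • ((N : ℝ)⁻¹ • ∑ k ∈ Finset.range N, x (φ k))
      = ((N : ℝ) + 1)⁻¹ • x (φ N) := by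
    rw [Finset.sum_range_succ, smul_smul, smul_add]
    have : (N : ℝ) / ((N : ℝ) + 1) * (N : ℝ)⁻¹ = ((N : ℝ) + 1)⁻¹ := by field_simp
    rw [this]; push_cast; abel
  simp only [Function.comp_apply] at hN
  rw [h6, norm_smul, norm_inv, Real.norm_of_nonneg (by positivity),
    inv_mul_lt_iff₀ (by positivity)] at hN
  have h7 := hx (φ N)
  have h8 : (N : ℝ) ≤ φ N := by exact_mod_cast hφ.id_le N
  linarith

lemma bs_exists_functional {X : Type*} [NormedAddCommGroup X] [NormedSpace ℝ X]
    (F : StrongDual ℝ (StrongDual ℝ X)) (d : ℝ) (hd : 0 < d)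
    (hF : ∀ x : X, d ≤ ‖F - NormedSpace.inclusionInDoubleDual ℝ X x‖) (s : Set X)
    (hs : s.Finite) :
    ∃ f : StrongDual ℝ X, ‖f‖ ≤ 1 ∧ (∀ x ∈ s, f x = 0) ∧ d / 2 < F f := by
  by_contra! hcon
  have := hs.to_subtype
  let Lm : s → (StrongDual ℝ X →ₗ[ℝ] ℝ) :=
    fun x => (NormedSpace.inclusionInDoubleDual ℝ X (x : X)).toLinearMap
  let p : Submodule ℝ (StrongDual ℝ X) := ⨅ i, LinearMap.ker (Lm i)
  have hp : ∀ f : p, ∀ x ∈ s, (f : StrongDual ℝ X) x = 0 := by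
    rintro ⟨f, hf⟩ x hx
    have := (Submodule.mem_iInf _).1 hf ⟨x, hx⟩
    simpa [Lm] using this
  obtain ⟨g, hg, hgn⟩ := exists_extension_norm_eq p (F.comp p.subtypeL)
  have hn : ‖g‖ ≤ d / 2 := by
    rw [hgn]
    refine ContinuousLinearMap.opNorm_le_of_unit_norm (by positivity) fun f hf => ?_
    have hf1 : ‖(f : StrongDual ℝ X)‖ = 1 := hf
    have a1 := hcon f hf1.le (hp f)
    have a2 := hcon (-f : p) (by simp [hf1]) (hp (-f))
    simp only [NegMemClass.coe_neg, map_neg] at a2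
    rw [Real.norm_eq_abs, abs_le]
    constructor
    · simp; linarith
    · simpa using a1
  have hmem : (F - g).toLinearMap ∈ Submodule.span ℝ (Set.range Lm) := by
    apply mem_span_of_iInf_ker_le_ker
    intro f hf
    have := hg ⟨f, hf⟩
    simp at this
    simp [this]
  have hle : Submodule.span ℝ (Set.range Lm) ≤
      LinearMap.range ((ContinuousLinearMap.coeLM ℝ :
        StrongDual ℝ (StrongDual ℝ X) →ₗ[ℝ] _).comp
        (NormedSpace.inclusionInDoubleDual ℝ X).toLinearMap) := by
    rw [Submodule.span_le]
    rintro _ ⟨x, rfl⟩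
    exact ⟨x, rfl⟩
  obtain ⟨x, hx⟩ := hle hmem
  have hx' : NormedSpace.inclusionInDoubleDual ℝ X x = F - g :=
    ContinuousLinearMap.coe_injective hx
  have := hF x
  have e : F - (F - g) = g := by ext f; simp
  rw [hx', e] at this
  linarith

lemma bs_closure_subset {X : Type*} [NormedAddCommGroup X] [NormedSpace ℝ X] [CompleteSpace X]
    (A : Set X) (hA : IsBanachSaksSet A) :
    closure (NormedSpace.inclusionInDoubleDualWeak ℝ X '' ((toWeakSpace ℝ X) '' A)) ⊆
      Set.range (NormedSpace.inclusionInDoubleDualWeak ℝ X) := by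
  intro F₀ hF₀
  by_contra hnot
  let F : StrongDual ℝ (StrongDual ℝ X) := WeakDual.toStrongDual F₀
  have hcl : IsClosed (Set.range (NormedSpace.inclusionInDoubleDual ℝ X)) := by
    have hi : Isometry (NormedSpace.inclusionInDoubleDual ℝ X) :=
      (NormedSpace.inclusionInDoubleDualLi (E := X) ℝ).isometry
    exact hi.isClosedEmbedding.isClosed_range
  have hF : F ∉ Set.range (NormedSpace.inclusionInDoubleDual ℝ X) := by
    rintro ⟨x, hx⟩
    exact hnot ⟨toWeakSpace ℝ X x, hx⟩
  have hd := (hcl.notMem_iff_infDist_pos (Set.range_nonempty _)).1 hF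
  set d := Metric.infDist F (Set.range (NormedSpace.inclusionInDoubleDual ℝ X))
  have hdx : ∀ x : X, d ≤ ‖F - NormedSpace.inclusionInDoubleDual ℝ X x‖ := fun x => by
    refine le_trans ?_ (dist_eq_norm F (NormedSpace.inclusionInDoubleDual ℝ X x)).le
    exact Metric.infDist_le_dist_of_mem ⟨x, rfl⟩
  -- weak-star approximation
  have happ : ∀ t : Finset (StrongDual ℝ X), (∀ f ∈ t, d / 2 < F f) →
      ∃ x ∈ A, ∀ f ∈ t, d / 2 < f x := by
    intro t ht
    have hev : ∀ᶠ G : WeakDual ℝ (StrongDual ℝ X) in nhds F₀, ∀ f ∈ t, d / 2 < G f := by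
      rw [Filter.eventually_all_finset]
      intro f hf
      exact (WeakDual.eval_continuous f).continuousAt.eventually (lt_mem_nhds (ht f hf))
    obtain ⟨G, hG, hG2⟩ := mem_closure_iff_nhds.1 hF₀ _ hev
    obtain ⟨_, ⟨x, hx, rfl⟩, rfl⟩ := hG2
    exact ⟨x, hx, hG⟩
  obtain ⟨u, hu, hr⟩ := exists_seq_of_forall_finset_exists
    (fun q : X × StrongDual ℝ X => q.1 ∈ A ∧ ‖q.2‖ ≤ 1 ∧ d / 2 < F q.2 ∧ d / 2 < q.2 q.1)
    (fun q q' => q'.2 q.1 = 0 ∧ d / 2 < q.2 q'.1) (by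
      classical
      intro s hs
      obtain ⟨f, hf1, hf0, hfF⟩ := bs_exists_functional F d hd hdx (Prod.fst '' (s : Set (X × StrongDual ℝ X)))
        (s.finite_toSet.image _)
      obtain ⟨x, hxA, hx⟩ := happ (insert f (s.image Prod.snd)) (by
        intro g hg
        rcases Finset.mem_insert.1 hg with rfl | hg
        · exact hfF
        · obtain ⟨q, hq, rfl⟩ := Finset.mem_image.1 hg
          exact (hs q hq).2.2.1)
      refine ⟨(x, f), ⟨hxA, hf1, hfF, hx f (Finset.mem_insert_self _ _)⟩, fun q hq => ⟨?_, ?_⟩⟩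
      · exact hf0 _ ⟨q, hq, rfl⟩
      · exact hx _ (Finset.mem_insert_of_mem (Finset.mem_image_of_mem _ hq)))
  obtain ⟨φ, hφ, L, hL⟩ := hA (fun n => (u n).1) fun n => (hu n).1
  have hge : ∀ m n, m ≤ n → d / 2 < (u m).2 (u n).1 := by
    intro m n hmn
    rcases hmn.eq_or_lt with rfl | h
    · exact (hu m).2.2.2
    · exact (hr m n h).2
  set σ : ℕ → X := fun N : ℕ => (N : ℝ)⁻¹ • ∑ k ∈ Finset.range N, (u (φ k)).1 with hσ
  have hzero : ∀ m, (u (φ m)).2 (σ m) = 0 := by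
    intro m
    simp only [hσ, map_smul, map_sum]
    rw [Finset.sum_eq_zero, smul_zero]
    intro k hk
    exact (hr _ _ (hφ (Finset.mem_range.1 hk))).1
  have hlow : ∀ m, d / 2 ≤ (u (φ m)).2 L := by
    intro m
    have t1 : Tendsto (fun N => (u (φ m)).2 (σ N)) atTop (nhds ((u (φ m)).2 L)) :=
      ((u (φ m)).2.continuous.tendsto L).comp hL
    have t2 : Tendsto (fun N : ℕ => (1 - (m : ℝ) / N) * (d / 2)) atTop
        (nhds ((1 - 0) * (d / 2))) :=
      (tendsto_const_nhds.sub (tendsto_const_div_atTop_nhds_zero_nat _)).mul_const _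
    have t3 : (1 - 0) * (d / 2) ≤ (u (φ m)).2 L := by
      refine le_of_tendsto_of_tendsto t2 t1 ?_
      filter_upwards [eventually_ge_atTop (m + 1)] with N hN
      have hN0 : (0 : ℝ) < N := by exact_mod_cast (by omega : 0 < N)
      simp only [hσ, map_smul, map_sum, smul_eq_mul]
      rw [← Finset.sum_range_add_sum_Ico _ (by omega : m ≤ N), Finset.sum_eq_zero
        (fun k hk => (hr _ _ (hφ (Finset.mem_range.1 hk))).1), zero_add]
      have hsum := Finset.card_nsmul_le_sum (Finset.Ico m N)
        (fun k => (u (φ m)).2 (u (φ k)).1) (d / 2)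
        (fun k hk => (hge _ _ (hφ.monotone (Finset.mem_Ico.1 hk).1)).le)
      rw [Nat.card_Ico, nsmul_eq_mul, Nat.cast_sub (by omega)] at hsum
      rw [le_inv_mul_iff₀ hN0]
      refine le_trans (le_of_eq ?_) hsum
      field_simp
    linarith
  have hlim := (tendsto_const_nhds (x := L)).sub hL |>.norm
  rw [sub_self, norm_zero] at hlim
  obtain ⟨m, hm⟩ := (hlim.eventually (gt_mem_nhds (half_pos hd))).exists
  have h1 := (u (φ m)).2.le_of_opNorm_le (hu (φ m)).2.1 (L - σ m)
  rw [map_sub, hzero, sub_zero, one_mul] at h1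
  have h2 := le_abs_self ((u (φ m)).2 L)
  rw [Real.norm_eq_abs] at h1
  have h3 := hlow m
  have h4 : ‖L - σ m‖ < d / 2 := hm
  linarith

/-- Every Banach-Saks subset of a Banach space is relatively weakly compact. -/
theorem banachSaks_relatively_weakly_compact {X : Type*} [NormedAddCommGroup X]
    [NormedSpace ℝ X] [CompleteSpace X] (A : Set X) (hA : IsBanachSaksSet A) :
    IsCompact (closure ((toWeakSpace ℝ X) '' A)) := by
  refine NormedSpace.isCompact_closure_of_isBounded ℝ X _ ?_ (bs_closure_subset A hA)
  rw [Set.preimage_image_eq _ (toWeakSpace ℝ X).injective]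
  exact bs_isBounded A hA
end

section
/- If X is a Banach space with the weak Banach-Saks property, then the convex hull of every Banach-Saks subset of X is again a Banach-Saks set. -/
open Filter

/-- A Banach space has the weak Banach-Saks property if every weakly convergent sequence
has a Cesàro-convergent subsequence. -/
def WeakBanachSaks (X : Type*) [NormedAddCommGroup X] [NormedSpace ℝ X] : Prop :=
  ∀ (x : ℕ → X) (x₀ : X),
    (∀ f : X →L[ℝ] ℝ, Tendsto (fun n => f (x n)) atTop (nhds (f x₀))) →
    ∃ φ : ℕ → ℕ, StrictMono φ ∧ ∃ L : X,
      Tendsto (fun N : ℕ => (N : ℝ)⁻¹ • ∑ k ∈ Finset.range N, x (φ k)) atTop (nhds L)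

namespace BSaux

open Topology

/-- Step of the combinatorial lemma. -/
lemma step {α : Type*} (P : Set α → ℝ) (h0 : ∀ B, 0 ≤ P B) (h1 : ∀ B, P B ≤ 1)
    (hadd : ∀ B C, P B = P (B ∩ C) + P (B \ C)) (E : ℕ → Set α) (B : Set α) (M : Set ℕ)
    (hM : M.Infinite) (ε : ℝ) (hε : 0 < ε) (hE : ∀ m ∈ M, ε ≤ P (B ∩ E m)) :
    ∃ m ∈ M, ∃ M' ⊆ M, M'.Infinite ∧ (∀ m' ∈ M', m < m') ∧
      ∃ ε' > 0, ∀ m' ∈ M', ε' ≤ P ((B ∩ E m) ∩ E m') := by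
  have hempty : P ∅ = 0 := by
    have := hadd ∅ ∅
    simp at this
    exact this
  have hmono : ∀ B C : Set α, B ⊆ C → P B ≤ P C := by
    intro B C h
    have := hadd C B
    rw [Set.inter_eq_self_of_subset_right h] at this
    linarith [h0 (C \ B)]
  have hsub : ∀ B C : Set α, P (B ∪ C) ≤ P B + P C := by
    intro B C
    have h := hadd (B ∪ C) B
    have h2 := hmono ((B ∪ C) ∩ B) B Set.inter_subset_right
    have h3 := hmono ((B ∪ C) \ B) C (by intro x; simp; tauto)
    linarith
  have hsum : ∀ (C : Set α) (J : Finset ℕ),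
      P (C ∩ ⋃ j ∈ J, E j) ≤ ∑ j ∈ J, P (C ∩ E j) := by
    intro C J
    classical
    induction J using Finset.induction_on with
    | empty => simp [hempty]
    | insert a s ha ih =>
      rw [Finset.sum_insert ha, Finset.set_biUnion_insert, Set.inter_union_distrib_left]
      linarith [hsub (C ∩ E a) (C ∩ ⋃ j ∈ s, E j)]
  -- almost maximal union
  let S : Set ℝ := {r | ∃ J : Finset ℕ, (↑J : Set ℕ) ⊆ M ∧ r = P (B ∩ ⋃ j ∈ J, E j)}
  have hSne : S.Nonempty := ⟨_, ∅, by simp, rfl⟩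
  have hSb : BddAbove S := ⟨1, by rintro r ⟨J, _, rfl⟩; exact h1 _⟩
  obtain ⟨r, ⟨J, hJ, rfl⟩, hr⟩ := exists_lt_of_lt_csSup hSne (show sSup S - ε / 2 < sSup S by linarith)
  have key : ∀ m' ∈ M, ε / 2 ≤ ∑ j ∈ J, P ((B ∩ E j) ∩ E m') := by
    intro m' hm'
    classical
    have hins : P (B ∩ ⋃ j ∈ insert m' J, E j) ≤ sSup S := by
      apply le_csSup hSb
      refine ⟨insert m' J, ?_, rfl⟩
      intro x hx
      simp at hx
      rcases hx with rfl | hx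
      · exact hm'
      · exact hJ (by simpa using hx)
    rw [Finset.set_biUnion_insert] at hins
    set V := ⋃ j ∈ J, E j with hV
    have e1 := hadd (B ∩ (E m' ∪ V)) V
    have e2 := hadd (B ∩ E m') V
    have e3 : (B ∩ (E m' ∪ V)) ∩ V = B ∩ V := by ext x; simp; tauto
    have e4 : (B ∩ (E m' ∪ V)) \ V = (B ∩ E m') \ V := by ext x; simp; tauto
    rw [e3, e4] at e1
    have e5 := hsum (B ∩ E m') J
    have e6 : ∑ j ∈ J, P (B ∩ E m' ∩ E j) = ∑ j ∈ J, P ((B ∩ E j) ∩ E m') := by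
      refine Finset.sum_congr rfl fun j _ => ?_
      rw [Set.inter_right_comm]
    have := hE m' hm'
    rw [e6] at e5
    linarith
  obtain ⟨m0, hm0⟩ := hM.nonempty
  have hJne : J.Nonempty := by
    by_contra h
    rw [Finset.not_nonempty_iff_eq_empty] at h
    have := key m0 hm0
    rw [h] at this
    simp at this
    linarith
  have hcard : (0 : ℝ) < J.card := by exact_mod_cast hJne.card_pos
  set δ := ε / 2 / J.card with hδ
  have hδ0 : 0 < δ := by positivity
  have key2 : ∀ m' ∈ M, ∃ j ∈ J, δ ≤ P ((B ∩ E j) ∩ E m') := by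
    intro m' hm'
    by_contra! h
    have h2 := Finset.sum_lt_sum_of_nonempty hJne h
    rw [Finset.sum_const, nsmul_eq_mul, hδ, mul_div_cancel₀ _ hcard.ne'] at h2
    linarith [key m' hm']
  have hcover : M ⊆ ⋃ j ∈ J, {m' ∈ M | δ ≤ P ((B ∩ E j) ∩ E m')} := by
    intro m' hm'
    obtain ⟨j, hj, h⟩ := key2 m' hm'
    simp only [Set.mem_iUnion]
    exact ⟨j, hj, hm', h⟩
  have : ∃ j ∈ J, {m' ∈ M | δ ≤ P ((B ∩ E j) ∩ E m')}.Infinite := by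
    by_contra! h
    refine hM (Set.Finite.subset ?_ hcover)
    refine Set.Finite.biUnion J.finite_toSet ?_
    intro j hj
    exact Set.not_infinite.mp (by simpa using h j hj)
  obtain ⟨j, hj, hinf⟩ := this
  refine ⟨j, hJ hj, {m' ∈ M | δ ≤ P ((B ∩ E j) ∩ E m')} \ Set.Iic j, ?_, ?_, ?_, δ, hδ0, ?_⟩
  · intro x hx; exact hx.1.1
  · exact hinf.sdiff (Set.finite_Iic j)
  · intro m' hm'; simpa using hm'.2
  · intro m' hm'; exact hm'.1.2

lemma comb {α : Type*} (P : Set α → ℝ) (h0 : ∀ B, 0 ≤ P B) (h1 : ∀ B, P B ≤ 1)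
    (hadd : ∀ B C, P B = P (B ∩ C) + P (B \ C)) (E : ℕ → Set α)
    (ε : ℝ) (hε : 0 < ε) (hE : ∀ m, ε ≤ P (E m)) :
    ∃ m : ℕ → ℕ, StrictMono m ∧ ∀ j, ∃ a, ∀ i ≤ j, a ∈ E (m i) := by
  have hempty : P ∅ = 0 := by
    have := hadd ∅ ∅
    simp at this
    exact this
  let Good : Set α × Set ℕ → Prop := fun s => s.2.Infinite ∧ ∃ ε > 0, ∀ m ∈ s.2, ε ≤ P (s.1 ∩ E m)
  have hstep : ∀ s : {s // Good s}, ∃ (m : ℕ) (s' : {s // Good s}), m ∈ s.1.2 ∧ s'.1.2 ⊆ s.1.2 ∧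
      (∀ m' ∈ s'.1.2, m < m') ∧ s'.1.1 = s.1.1 ∩ E m := by
    rintro ⟨⟨B, M⟩, hM, ε, hε, h⟩
    obtain ⟨m, hm, M', hs, hinf, hlt, ε', hε', h'⟩ := step P h0 h1 hadd E B M hM ε hε h
    exact ⟨m, ⟨(B ∩ E m, M'), hinf, ε', hε', h'⟩, hm, hs, hlt, rfl⟩
  choose nm ns a1 a2 a3 a4 using hstep
  let s0 : {s // Good s} := ⟨(Set.univ, Set.univ), Set.infinite_univ, ε, hε, by simpa using hE⟩
  let st : ℕ → {s // Good s} := fun n => Nat.rec s0 (fun _ s => ns s) n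
  have hst : ∀ n, st (n + 1) = ns (st n) := fun n => rfl
  have hne : ∀ n, (st n).1.1.Nonempty := by
    intro n
    obtain ⟨hinf, ε, hε, h⟩ := (st n).2
    obtain ⟨m, hm⟩ := hinf.nonempty
    by_contra hc
    rw [Set.not_nonempty_iff_eq_empty] at hc
    have := h m hm
    rw [hc, Set.empty_inter, hempty] at this
    linarith
  refine ⟨fun n => nm (st n), strictMono_nat_of_lt_succ fun n => ?_, fun j => ?_⟩
  · apply a3 (st n)
    rw [← hst]
    exact a1 _
  · obtain ⟨a, ha⟩ := hne (j + 1)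
    refine ⟨a, ?_⟩
    have hanti : ∀ d i, (st (i + d)).1.1 ⊆ (st i).1.1 := by
      intro d i
      induction d with
      | zero => exact subset_rfl
      | succ d ih =>
        refine subset_trans ?_ ih
        rw [← add_assoc, hst, a4]
        exact Set.inter_subset_left
    intro i hi
    have h := hanti (j - i) (i + 1)
    rw [show i + 1 + (j - i) = j + 1 by omega] at h
    have h2 := h ha
    rw [hst, a4] at h2
    exact h2.2

lemma ultra_lim {ι : Type*} (U : Ultrafilter ι) (u : ι → ℝ) (C : ℝ) (h : ∀ n, |u n| ≤ C) :
    ∃ l, Tendsto u U (𝓝 l) := by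
  have := (isCompact_Icc (a := -C) (b := C)).ultrafilter_le_nhds' (U.map u)
    (by
      rw [Ultrafilter.mem_map]
      exact Filter.univ_mem' fun n => abs_le.mp (h n))
  obtain ⟨l, _, hl⟩ := this
  exact ⟨l, hl⟩

variable {X : Type*} [NormedAddCommGroup X] [NormedSpace ℝ X]

lemma bounded (A : Set X) (hA : IsBanachSaksSet A) : ∃ R : ℝ, 0 ≤ R ∧ ∀ a ∈ A, ‖a‖ ≤ R := by
  by_contra! hc
  have : ∀ n : ℕ, ∃ a ∈ A, (n : ℝ) + 1 < ‖a‖ := fun n => hc _ (by positivity)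
  choose a haA ha using this
  obtain ⟨φ, hφ, L, hL⟩ := hA a haA
  have h1 := (tendsto_add_atTop_iff_nat 1).mpr hL
  have h2 : Tendsto (fun N : ℕ => ((N : ℝ) / (N + 1)) • ((N : ℝ)⁻¹ • ∑ k ∈ Finset.range N, a (φ k)))
      atTop (𝓝 ((1 : ℝ) • L)) := (tendsto_natCast_div_add_atTop (1 : ℝ)).smul hL
  have h3 := (h1.sub h2).norm
  rw [one_smul, sub_self, norm_zero] at h3
  have h4 := h3.eventually (gt_mem_nhds (show (0 : ℝ) < 1 by norm_num))
  obtain ⟨N, hN, hN0⟩ := (h4.and (eventually_gt_atTop 0)).exists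
  have hNr : (0 : ℝ) < N := by exact_mod_cast hN0
  have e : (((N + 1 : ℕ) : ℝ)⁻¹ • ∑ k ∈ Finset.range (N + 1), a (φ k)) -
      ((N : ℝ) / (N + 1)) • ((N : ℝ)⁻¹ • ∑ k ∈ Finset.range N, a (φ k)) =
      ((N : ℝ) + 1)⁻¹ • a (φ N) := by
    rw [smul_smul, show (N : ℝ) / (N + 1) * (N : ℝ)⁻¹ = ((N : ℝ) + 1)⁻¹ by field_simp,
      Finset.sum_range_succ]
    push_cast
    rw [smul_add]
    abel
  rw [e, norm_smul, Real.norm_of_nonneg (by positivity), inv_mul_lt_iff₀ (by positivity)] at hN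
  have h5 := ha (φ N)
  have h6 : (N : ℝ) ≤ φ N := by exact_mod_cast hφ.le_apply
  linarith

lemma cesaro_ge (u : ℕ → ℝ) (c l : ℝ) (h : ∀ᶠ n in atTop, c ≤ u n)
    (hl : Tendsto (fun N : ℕ => (N : ℝ)⁻¹ * ∑ k ∈ Finset.range N, u k) atTop (𝓝 l)) : c ≤ l := by
  have h1 : Tendsto (fun n => min (u n) c) atTop (𝓝 c) := by
    refine tendsto_const_nhds.congr' ?_
    filter_upwards [h] with n hn
    rw [min_eq_right hn]
  refine le_of_tendsto_of_tendsto' h1.cesaro hl fun N => ?_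
  gcongr
  exact min_le_left _ _

lemma sub_mem_ball_aux {E : Type*} [NormedAddCommGroup E] (a b : E) (d : ℝ) (h : ‖b‖ < d) :
    a - b ∈ Metric.ball a d := by
  rw [Metric.mem_ball, dist_eq_norm, sub_sub_cancel_left, norm_neg]
  exact h

/-- Functionals separating an element of the bidual from `X`. -/
lemma sep [CompleteSpace X] (ψ : StrongDual ℝ (StrongDual ℝ X))
    (hψ : ∀ x : X, NormedSpace.inclusionInDoubleDual ℝ X x ≠ ψ) (s : ℕ → X) :
    ∃ C : ℝ, 0 ≤ C ∧ ∀ m : ℕ, ∃ f : StrongDual ℝ X, ‖f‖ ≤ C ∧ (∀ j ≤ m, f (s j) = 0) ∧ ψ f = 1 := by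
  let ι := NormedSpace.inclusionInDoubleDualLi (𝕜 := ℝ) (E := X)
  have hcl : IsClosed (Set.range ι) := ι.isometry.isUniformInducing.isComplete_range.isClosed
  have hnot : ψ ∈ (Set.range ι)ᶜ := by
    rintro ⟨x, hx⟩
    exact hψ x hx
  obtain ⟨d, hd, hball⟩ := Metric.isOpen_iff.mp hcl.isOpen_compl ψ hnot
  refine ⟨(d / 2)⁻¹, by positivity, fun m => ?_⟩
  by_contra! hc
  let F : Submodule ℝ (StrongDual ℝ X) :=
    ⨅ j : Fin (m + 1), LinearMap.ker (ι (s j) : StrongDual ℝ X →ₗ[ℝ] ℝ)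
  have hF : ∀ f ∈ F, ∀ j ≤ m, f (s j) = 0 := by
    intro f hf j hj
    have := (Submodule.mem_iInf _).mp hf ⟨j, by omega⟩
    exact this
  have hbd : ∀ f : F, ‖(ψ.comp F.subtypeL) f‖ ≤ d / 2 * ‖f‖ := by
    rintro ⟨f, hf⟩
    by_contra! hlt
    simp at hlt
    have hne : ψ f ≠ 0 := by
      intro h0
      rw [h0] at hlt
      simp at hlt
      have : 0 ≤ d / 2 * ‖f‖ := by positivity
      linarith
    refine hc ((ψ f)⁻¹ • f) ?_ ?_ ?_
    · rw [norm_smul, norm_inv, Real.norm_eq_abs, inv_mul_le_iff₀ (abs_pos.mpr hne),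
        le_mul_inv_iff₀ (by positivity)]
      linarith
    · intro j hj
      simp [hF f hf j hj]
    · simp [hne]
  obtain ⟨ψ', hext, hnorm⟩ := exists_extension_norm_eq F (ψ.comp F.subtypeL)
  have hnorm' : ‖ψ'‖ ≤ d / 2 := by
    rw [hnorm]
    exact ContinuousLinearMap.opNorm_le_bound _ (by positivity) hbd
  have hker : F ≤ LinearMap.ker ((ψ - ψ' : StrongDual ℝ (StrongDual ℝ X)) : StrongDual ℝ X →ₗ[ℝ] ℝ) := by
    intro f hf
    have := hext ⟨f, hf⟩
    simp at this
    simp [this]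
  have hspan := mem_span_of_iInf_ker_le_ker (L := fun j : Fin (m + 1) => (ι (s j) : StrongDual ℝ X →ₗ[ℝ] ℝ)) hker
  obtain ⟨c, hc'⟩ := (Submodule.mem_span_range_iff_exists_fun ℝ).mp hspan
  have hx : ι (∑ j, c j • s j) = ψ - ψ' := by
    ext f
    have := LinearMap.congr_fun hc' f
    simp at this
    have e : ∀ x : X, ι x f = f x := fun x => rfl
    simp only [e] at this ⊢
    simp [this]
  have : ψ - ψ' ∈ Metric.ball ψ d := by
    exact sub_mem_ball_aux (E := StrongDual ℝ (StrongDual ℝ X)) ψ ψ' d (by linarith)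
  exact hball this ⟨_, hx⟩

lemma tendsto_zero_closure (S : Set X) (f : ℕ → StrongDual ℝ X) (C : ℝ) (hC : ∀ m, ‖f m‖ ≤ C)
    (h : ∀ s ∈ S, Tendsto (fun m => f m s) atTop (𝓝 0)) (L : X)
    (hL : L ∈ (Submodule.span ℝ S).topologicalClosure) :
    Tendsto (fun m => f m L) atTop (𝓝 0) := by
  have hspan : ∀ z ∈ Submodule.span ℝ S, Tendsto (fun m => f m z) atTop (𝓝 0) := by
    intro z hz
    induction hz using Submodule.span_induction with
    | mem x hx => exact h x hx
    | zero => simp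
    | add x y _ _ hx hy => simpa using hx.add hy
    | smul a x _ hx => simpa using hx.const_mul a
  have hC0 : 0 ≤ C := (norm_nonneg _).trans (hC 0)
  rw [Metric.tendsto_atTop]
  intro ε hε
  obtain ⟨z, hz, hzL⟩ := Metric.mem_closure_iff.mp hL (ε / 2 / (C + 1)) (by positivity)
  obtain ⟨N, hN⟩ := Metric.tendsto_atTop.mp (hspan z hz) (ε / 2) (by positivity)
  refine ⟨N, fun m hm => ?_⟩
  have h1 := hN m hm
  rw [dist_zero_right] at h1 ⊢
  have h2 : ‖f m (L - z)‖ ≤ C * ‖L - z‖ := (f m).le_of_opNorm_le (hC m) _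
  rw [dist_eq_norm, lt_div_iff₀ (by positivity)] at hzL
  have h3 : f m L = f m (L - z) + f m z := by simp
  have h4 := norm_add_le (f m (L - z)) (f m z)
  rw [h3]
  nlinarith [norm_nonneg (L - z)]

/-- Every ultrafilter limit of a sequence in the convex hull lies in `X`. -/
lemma ultra_weak [CompleteSpace X] (A : Set X) (hA : IsBanachSaksSet A) (y : ℕ → X)
    (hy : ∀ n, y n ∈ convexHull ℝ A) (U : Ultrafilter ℕ) :
    ∃ z : X, ∀ f : X →L[ℝ] ℝ, Tendsto (fun n => f (y n)) U (𝓝 (f z)) := by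
  classical
  obtain ⟨R, hR0, hR⟩ := bounded A hA
  have hw : ∀ n, ∃ (t : Finset X) (w : X → ℝ), (↑t : Set X) ⊆ A ∧ (∀ a ∈ t, 0 ≤ w a) ∧
      ∑ a ∈ t, w a = 1 ∧ ∑ a ∈ t, w a • a = y n := by
    intro n
    have := hy n
    rw [convexHull_eq_union_convexHull_finite_subsets] at this
    simp only [Set.mem_iUnion] at this
    obtain ⟨t, ht, hx⟩ := this
    obtain ⟨w, h1, h2, h3⟩ := Finset.mem_convexHull'.mp hx
    exact ⟨t, w, ht, h1, h2, h3⟩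
  choose t w htA hw0 hw1 hwy using hw
  have hyR : ∀ n, ‖y n‖ ≤ R := by
    intro n
    rw [← hwy n]
    calc ‖∑ a ∈ t n, w n a • a‖ ≤ ∑ a ∈ t n, w n a * R := by
          refine norm_sum_le_of_le _ fun a ha => ?_
          rw [norm_smul, Real.norm_of_nonneg (hw0 n a ha)]
          exact mul_le_mul_of_nonneg_left (hR a (htA n ha)) (hw0 n a ha)
      _ = R := by rw [← Finset.sum_mul, hw1, one_mul]
  have hfb : ∀ (f : StrongDual ℝ X) n, |f (y n)| ≤ R * ‖f‖ := by
    intro f n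
    rw [mul_comm, ← Real.norm_eq_abs]
    exact f.le_opNorm_of_le (hyR n)
  choose g hg using fun f : StrongDual ℝ X => ultra_lim U (fun n => f (y n)) _ (hfb f)
  let ψl : StrongDual ℝ X →ₗ[ℝ] ℝ :=
    { toFun := g
      map_add' := fun f f' => tendsto_nhds_unique (hg (f + f')) ((hg f).add (hg f'))
      map_smul' := fun c f => tendsto_nhds_unique (hg (c • f)) ((hg f).const_mul c) }
  let ψ : StrongDual ℝ (StrongDual ℝ X) := ψl.mkContinuous R (fun f => by
    exact le_of_tendsto (hg f).norm (Filter.Eventually.of_forall fun n => hfb f n))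
  have hψ : ∀ f, Tendsto (fun n => f (y n)) U (𝓝 (ψ f)) := hg
  by_cases hin : ∃ z : X, NormedSpace.inclusionInDoubleDual ℝ X z = ψ
  · obtain ⟨z, hz⟩ := hin
    refine ⟨z, fun f => ?_⟩
    have := hψ f
    rw [← hz] at this
    simpa using this
  exfalso
  push Not at hin
  -- a sequence enumerating the supports
  set T : Set X := ⋃ n, (↑(t n) : Set X) with hT
  have hTA : T ⊆ A := Set.iUnion_subset htA
  have hTc : T.Countable := Set.countable_iUnion fun n => (t n).countable_toSet
  have hTne : T.Nonempty := by
    have : (t 0).Nonempty := by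
      by_contra h
      rw [Finset.not_nonempty_iff_eq_empty] at h
      have h2 := hw1 0
      rw [h] at h2
      simp at h2
    obtain ⟨a, ha⟩ := this
    exact ⟨a, Set.mem_iUnion.mpr ⟨0, ha⟩⟩
  obtain ⟨s, hs⟩ := hTc.exists_eq_range hTne
  obtain ⟨C, hC0, hf⟩ := sep ψ hin s
  choose f hfC hfs hfψ using hf
  -- the finitely additive measure
  let p : ℕ → Set X → ℝ := fun n B => ∑ a ∈ t n, B.indicator (w n) a
  have hp0 : ∀ n B, 0 ≤ p n B := fun n B => Finset.sum_nonneg fun a ha => by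
    by_cases h : a ∈ B
    · simpa [h] using hw0 n a ha
    · simp [h]
  have hp1 : ∀ n B, p n B ≤ 1 := by
    intro n B
    rw [← hw1 n]
    refine Finset.sum_le_sum fun a ha => ?_
    by_cases h : a ∈ B
    · simp [h]
    · simpa [h] using hw0 n a ha
  have hpadd : ∀ n B D, p n B = p n (B ∩ D) + p n (B \ D) := by
    intro n B D
    rw [← Finset.sum_add_distrib]
    refine Finset.sum_congr rfl fun a _ => ?_
    by_cases h : a ∈ B <;> by_cases h' : a ∈ D <;> simp [h, h']
  choose P hP using fun B : Set X => ultra_lim U (fun n => p n B) 1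
    (fun n => by rw [abs_of_nonneg (hp0 n B)]; exact hp1 n B)
  have hP0 : ∀ B, 0 ≤ P B := fun B => ge_of_tendsto (hP B) (Filter.Eventually.of_forall fun n => hp0 n B)
  have hP1 : ∀ B, P B ≤ 1 := fun B => le_of_tendsto (hP B) (Filter.Eventually.of_forall fun n => hp1 n B)
  have hPadd : ∀ B D, P B = P (B ∩ D) + P (B \ D) := fun B D => by
    refine tendsto_nhds_unique (hP B) (((hP (B ∩ D)).add (hP (B \ D))).congr fun n => ?_)
    exact (hpadd n B D).symm
  let E : ℕ → Set X := fun m => {a | a ∈ T ∧ 1 / 2 ≤ f m a}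
  have hEm : ∀ m, 1 ≤ C * R * P (E m) + 1 / 2 := by
    intro m
    have h1 : Tendsto (fun n => C * R * p n (E m) + 1 / 2) U (𝓝 (C * R * P (E m) + 1 / 2)) :=
      ((hP (E m)).const_mul _).add_const _
    have h2 := hψ (f m)
    rw [hfψ] at h2
    refine le_of_tendsto_of_tendsto' h2 h1 fun n => ?_
    have h3 : (1 / 2 : ℝ) = ∑ a ∈ t n, w n a * (1 / 2) := by
      rw [← Finset.sum_mul, hw1, one_mul]
    rw [h3, Finset.mul_sum, ← Finset.sum_add_distrib, ← hwy n, map_sum]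
    refine Finset.sum_le_sum fun a ha => ?_
    rw [map_smul, smul_eq_mul]
    have haT : a ∈ T := Set.mem_iUnion.mpr ⟨n, ha⟩
    have hwn := hw0 n a ha
    by_cases h : a ∈ E m
    · rw [Set.indicator_of_mem h]
      have h5 : f m a ≤ C * R := by
        refine (le_abs_self _).trans ?_
        rw [← Real.norm_eq_abs]
        exact ((f m).le_of_opNorm_le (hfC m) a).trans
          (mul_le_mul_of_nonneg_left (hR a (hTA haT)) hC0)
      nlinarith
    · rw [Set.indicator_of_notMem h]
      have h5 : f m a < 1 / 2 := by
        by_contra! h6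
        exact h ⟨haT, h6⟩
      nlinarith
  have hCR0 : 0 ≤ C * R := by positivity
  have hE : ∀ m, 1 / (2 * (C * R + 1)) ≤ P (E m) := by
    intro m
    rw [div_le_iff₀ (by positivity)]
    nlinarith [hEm m, hP0 (E m)]
  obtain ⟨μ, hμ, hμE⟩ := comb P hP0 hP1 hPadd E _ (by positivity) hE
  choose a ha using hμE
  have haT : ∀ j, a j ∈ T := fun j => (ha j 0 (Nat.zero_le _)).1
  obtain ⟨φ, hφ, L, hL⟩ := hA a (fun j => hTA (haT j))
  have hLge : ∀ i, 1 / 2 ≤ f (μ i) L := by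
    intro i
    refine cesaro_ge (fun k => f (μ i) (a (φ k))) _ _ ?_ ?_
    · filter_upwards [eventually_ge_atTop i] with k hk
      exact (ha (φ k) i (hk.trans hφ.le_apply)).2
    · have := ((f (μ i)).continuous.tendsto L).comp hL
      refine this.congr fun N => ?_
      simp
  have hLc : L ∈ (Submodule.span ℝ T).topologicalClosure := by
    refine mem_closure_of_tendsto hL (Filter.Eventually.of_forall fun N => ?_)
    exact Submodule.smul_mem _ _ (Submodule.sum_mem _ fun k _ => Submodule.subset_span (haT _))
  have hz := tendsto_zero_closure T f C hfC (by
    intro x hx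
    rw [hs] at hx
    obtain ⟨j, rfl⟩ := hx
    refine tendsto_const_nhds.congr' ?_
    filter_upwards [eventually_ge_atTop j] with m hm
    exact (hfs m j hm).symm) L hLc
  have := ge_of_tendsto' (hz.comp hμ.tendsto_atTop) hLge
  norm_num at this

lemma exists_separating (s : ℕ → X) : ∃ f : ℕ → StrongDual ℝ X,
    ∀ z ∈ (Submodule.span ℝ (Set.range s)).topologicalClosure, (∀ j, f j z = 0) → z = 0 := by
  have hsep : TopologicalSpace.IsSeparable
      ((Submodule.span ℝ (Set.range s) : Set X)) :=
    (Set.countable_range s).isSeparable.span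
  obtain ⟨D, hD, hDc⟩ := hsep
  choose F hF1 hF2 using fun x : X => exists_dual_vector'' ℝ x
  have hDne : D.Nonempty := by
    by_contra h
    rw [Set.not_nonempty_iff_eq_empty] at h
    rw [h, closure_empty] at hDc
    exact hDc (Submodule.zero_mem _)
  obtain ⟨e, rfl⟩ := hD.exists_eq_range hDne
  refine ⟨fun j => F (e j), fun z hz h0 => ?_⟩
  have hz' : z ∈ closure (Set.range e) := by
    have := closure_mono hDc (show z ∈ closure _ from hz)
    rwa [closure_closure] at this
  by_contra hne
  have hpos : 0 < ‖z‖ := norm_pos_iff.mpr hne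
  obtain ⟨_, ⟨j, rfl⟩, hj⟩ := Metric.mem_closure_iff.mp hz' (‖z‖ / 2) (by positivity)
  rw [dist_eq_norm] at hj
  have h1 : ‖F (e j) (e j - z)‖ ≤ 1 * ‖e j - z‖ := (F (e j)).le_of_opNorm_le (hF1 _) _
  rw [map_sub, h0 j, sub_zero, hF2, one_mul, norm_sub_rev] at h1
  simp at h1
  have h2 : ‖z‖ ≤ ‖z - e j‖ + ‖e j‖ := by simpa using norm_add_le (z - e j) (e j)
  linarith

lemma weak_subseq [CompleteSpace X] (A : Set X) (hA : IsBanachSaksSet A) (y : ℕ → X)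
    (hy : ∀ n, y n ∈ convexHull ℝ A) :
    ∃ φ : ℕ → ℕ, StrictMono φ ∧ ∃ z : X, ∀ f : X →L[ℝ] ℝ,
      Tendsto (fun n => f (y (φ n))) atTop (𝓝 (f z)) := by
  obtain ⟨R, hR0, hR⟩ := bounded A hA
  have hyR : ∀ n, ‖y n‖ ≤ R := by
    intro n
    have : convexHull ℝ A ⊆ Metric.closedBall 0 R :=
      convexHull_min (fun a ha => by simpa using hR a ha) (convex_closedBall _ _)
    simpa using this (hy n)
  obtain ⟨f, hf⟩ := exists_separating y
  have hK : IsCompact (Set.pi Set.univ fun j => Set.Icc (-(‖f j‖ * R)) (‖f j‖ * R)) :=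
    isCompact_univ_pi fun j => isCompact_Icc
  obtain ⟨l, _, φ, hφ, hl⟩ := hK.tendsto_subseq (x := fun n j => f j (y n)) (by
    intro n j _
    exact abs_le.mp ((f j).le_opNorm_of_le (hyR n)))
  rw [tendsto_pi_nhds] at hl
  have hU := fun U : Ultrafilter ℕ => ultra_weak A hA (y ∘ φ) (fun n => hy _) U
  choose z hz using hU
  have hzl : ∀ U : Ultrafilter ℕ, (U : Filter ℕ) ≤ atTop → ∀ j, f j (z U) = l j := fun U hUa j =>
    tendsto_nhds_unique (hz U (f j)) ((hl j).mono_left hUa)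
  have hzm : ∀ U : Ultrafilter ℕ, z U ∈ (Submodule.span ℝ (Set.range y)).topologicalClosure := by
    intro U
    by_contra hn
    obtain ⟨g, u, h1, h2⟩ := geometric_hahn_banach_closed_point
      (Submodule.span ℝ (Set.range y)).topologicalClosure.convex
      (Submodule.isClosed_topologicalClosure _) hn
    have h3 : ∀ x ∈ (Submodule.span ℝ (Set.range y)).topologicalClosure, g x = 0 := by
      intro x hx
      by_contra hgx
      have h4 := h1 (((u + 1) / g x) • x) (Submodule.smul_mem _ _ hx)
      rw [map_smul, smul_eq_mul, div_mul_cancel₀ _ hgx] at h4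
      linarith
    have h5 := h1 0 (Submodule.zero_mem _)
    rw [map_zero] at h5
    have h6 : g (z U) = 0 := by
      refine tendsto_nhds_unique (hz U g) (tendsto_const_nhds.congr fun n => ?_)
      exact (h3 _ (Submodule.le_topologicalClosure _ (Submodule.subset_span ⟨_, rfl⟩))).symm
    linarith
  refine ⟨φ, hφ, z (Ultrafilter.of atTop), fun g => ?_⟩
  rw [tendsto_iff_ultrafilter]
  intro U hUa
  have heq : z U = z (Ultrafilter.of atTop) := by
    rw [← sub_eq_zero]
    refine hf _ (Submodule.sub_mem _ (hzm _) (hzm _)) fun j => ?_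
    rw [map_sub, hzl U hUa, hzl _ (Ultrafilter.of_le _), sub_self]
  rw [← heq]
  exact hz U g

end BSaux

/-- If `X` has the weak Banach-Saks property, then the convex hull of every Banach-Saks
subset of `X` is again a Banach-Saks set. -/
theorem convexHull_banachSaks_of_weakBanachSaks {X : Type*} [NormedAddCommGroup X]
    [NormedSpace ℝ X] [CompleteSpace X] (hX : WeakBanachSaks X)
    (A : Set X) (hA : IsBanachSaksSet A) :
    IsBanachSaksSet (convexHull ℝ A) := by
  intro y hy
  obtain ⟨φ, hφ, z, hz⟩ := BSaux.weak_subseq A hA y hy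
  obtain ⟨φ', hφ', L, hL⟩ := hX (fun n => y (φ n)) z hz
  exact ⟨φ ∘ φ', hφ.comp hφ', L, hL⟩
end

section
/- If a Banach-Saks subset A of a Banach space X is contained in the range of a countably additive X-valued vector measure, then conv(A) is also a Banach-Saks set. -/
open Filter MeasureTheory

namespace BSaux
open scoped ENNReal Topology

/-- The scalar measure obtained by composing with a functional. -/
noncomputable def sm {X Ω : Type*} [NormedAddCommGroup X] [NormedSpace ℝ X] [MeasurableSpace Ω]
    (μ : VectorMeasure Ω X) (l : StrongDual ℝ X) : SignedMeasure Ω :=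
  μ.mapRange (l : X →+ ℝ) l.continuous

lemma sm_apply {X Ω : Type*} [NormedAddCommGroup X] [NormedSpace ℝ X] [MeasurableSpace Ω]
    (μ : VectorMeasure Ω X) (l : StrongDual ℝ X) (E : Set Ω) : sm μ l E = l (μ E) := rfl

lemma tv_real_le {Ω : Type*} [MeasurableSpace Ω] (s : SignedMeasure Ω) {E : Set Ω}
    (hE : MeasurableSet E) {r : ℝ} (h : ∀ B, MeasurableSet B → B ⊆ E → |s B| ≤ r) :
    s.totalVariation.real E ≤ 2 * r := by
  obtain ⟨i, hi₁, hi₂, hi₃, hp, hn⟩ := s.toJordanDecomposition_spec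
  rw [SignedMeasure.totalVariation, measureReal_add_apply, hp, hn,
    SignedMeasure.toMeasureOfZeroLE_real_apply _ hi₂ hi₁ hE,
    SignedMeasure.toMeasureOfLEZero_real_apply _ hi₃ hi₁.compl hE]
  have h1 := (abs_le.1 (h _ (hi₁.inter hE) Set.inter_subset_right)).2
  have h2 := (abs_le.1 (h _ (hi₁.compl.inter hE) Set.inter_subset_right)).1
  linarith

lemma sm_zero_of_tv {Ω : Type*} [MeasurableSpace Ω] (s : SignedMeasure Ω) {E : Set Ω}
    (h : s.totalVariation E = 0) : s E = 0 :=
  s.null_of_totalVariation_zero h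

section
variable {X Ω : Type*} [NormedAddCommGroup X] [NormedSpace ℝ X] [MeasurableSpace Ω]

lemma cont_empty (μ : VectorMeasure Ω X) (F : ℕ → Set Ω) (hF : Antitone F)
    (hm : ∀ n, MeasurableSet (F n)) (he : ⋂ n, F n = ∅) {ε : ℝ} (hε : 0 < ε) :
    ∃ m, ∀ B, MeasurableSet B → B ⊆ F m → ‖μ B‖ < ε := by
  by_contra! hcon
  choose B hBm hBs hB using hcon
  have key : ∀ m, ∃ k, m < k ∧ ε / 2 ≤ ‖μ (B m \ F k)‖ := by
    intro m
    have ht : Tendsto (fun k => μ (B m ∩ F k)) atTop (𝓝 (μ (⋂ k, B m ∩ F k))) :=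
      VectorMeasure.tendsto_vectorMeasure_iInter_atTop_nat (v := μ) (s := fun k => B m ∩ F k)
        (fun a b hab => Set.inter_subset_inter_right _ (hF hab)) (fun k => (hBm m).inter (hm k))
    rw [← Set.inter_iInter, he, Set.inter_empty, VectorMeasure.empty] at ht
    have h1 : ∀ᶠ k in atTop, ‖μ (B m ∩ F k)‖ < ε / 2 := by
      have := ht.norm
      rw [norm_zero] at this
      exact this.eventually_lt_const (by positivity)
    obtain ⟨k, hk1, hk2⟩ := (h1.and (eventually_gt_atTop m)).exists
    refine ⟨k, hk2, ?_⟩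
    have h3 : μ (B m ∩ F k) + μ (B m \ F k) = μ (B m) := by
      rw [← VectorMeasure.of_union (Set.disjoint_sdiff_right.mono_left Set.inter_subset_right)
        ((hBm m).inter (hm k)) ((hBm m).diff (hm k)), Set.inter_union_sdiff]
    have h4 := hB m
    rw [← h3] at h4
    have h5 := norm_add_le (μ (B m ∩ F k)) (μ (B m \ F k))
    linarith
  choose k hk hk' using key
  let m : ℕ → ℕ := fun j => k^[j] 0
  have hms : ∀ j, m (j+1) = k (m j) := fun j => Function.iterate_succ_apply' _ _ _
  have hmm : StrictMono m := strictMono_nat_of_lt_succ (fun j => by rw [hms]; exact hk _)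
  let C : ℕ → Set Ω := fun j => B (m j) \ F (m (j+1))
  have hC : ∀ j, MeasurableSet (C j) := fun j => (hBm _).diff (hm _)
  have hd : Pairwise (Function.onFun Disjoint C) := by
    refine (pairwise_disjoint_on C).2 ?_
    intro i j hij
    refine Set.disjoint_left.2 fun x hx hx' => hx.2 ?_
    exact hF (hmm.monotone hij) (hBs _ hx'.1)
  have hs := (μ.m_iUnion hC hd).summable.tendsto_atTop_zero.norm
  rw [norm_zero] at hs
  obtain ⟨j, hj⟩ := (hs.eventually_lt_const (show 0 < ε / 2 by positivity)).exists
  have := hk' (m j)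
  rw [← hms] at this
  exact absurd hj (not_lt.2 this)

lemma exists_finset (μ : VectorMeasure Ω X) {ε : ℝ} (hε : 0 < ε) :
    ∃ S : Finset (StrongDual ℝ X), ∃ δ : ℝ≥0∞, 0 < δ ∧ ∀ E, MeasurableSet E →
      (∀ l ∈ S, (sm μ l).totalVariation E < δ) → ‖μ E‖ < ε := by
  classical
  by_contra! hcon
  obtain ⟨f, hf, hr⟩ := exists_seq_of_forall_finset_exists
    (α := ℕ × Set Ω × StrongDual ℝ X)
    (fun p => MeasurableSet p.2.1 ∧ ‖p.2.2‖ ≤ 1 ∧ p.2.2 (μ p.2.1) = ‖μ p.2.1‖ ∧ ε ≤ ‖μ p.2.1‖)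
    (fun p q => p.1 < q.1 ∧ (sm μ p.2.2).totalVariation q.2.1 < (2⁻¹ : ℝ≥0∞) ^ q.1) (by
      intro s hs
      let k := s.sup (fun p => p.1) + 1
      obtain ⟨E, hE, hE1, hE2⟩ := hcon (s.image (fun p => p.2.2)) ((2⁻¹ : ℝ≥0∞) ^ k)
        (ENNReal.pow_pos (by simp) _)
      obtain ⟨l, hl1, hl2⟩ := exists_dual_vector'' ℝ (μ E)
      refine ⟨(k, E, l), ⟨hE, hl1, by simpa using hl2, hE2⟩, fun p hp => ⟨?_, ?_⟩⟩
      · exact Nat.lt_succ_of_le (Finset.le_sup (f := fun p : ℕ × Set Ω × StrongDual ℝ X => p.1) hp)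
      · exact hE1 _ (Finset.mem_image_of_mem _ hp))
  let E : ℕ → Set Ω := fun n => (f n).2.1
  let l : ℕ → StrongDual ℝ X := fun n => (f n).2.2
  have hE : ∀ n, MeasurableSet (E n) := fun n => (hf n).1
  have hk : StrictMono (fun n => (f n).1) := fun a b hab => (hr a b hab).1
  have hb : ∀ i n, i < n → (sm μ (l i)).totalVariation (E n) ≤ (2⁻¹ : ℝ≥0∞) ^ n := by
    intro i n hin
    refine (hr i n hin).2.le.trans ?_
    exact pow_le_pow_right_of_le_one' (by simp) (hk.id_le n)
  let F : Set Ω := limsup E atTop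
  let G : ℕ → Set Ω := fun m => ⋃ n, E (n + m)
  have hFG : F = ⋂ m, G m := by
    simp only [F, G, limsup_eq_iInf_iSup_of_nat', Set.iSup_eq_iUnion, Set.iInf_eq_iInter]
  have hGm : ∀ m, MeasurableSet (G m) := fun m => MeasurableSet.iUnion fun n => hE _
  have hFm : MeasurableSet F := by rw [hFG]; exact MeasurableSet.iInter hGm
  have hGa : Antitone G := by
    intro a b hab x hx
    obtain ⟨n, hn⟩ := Set.mem_iUnion.1 hx
    refine Set.mem_iUnion.2 ⟨n + (b - a), ?_⟩
    rwa [show n + (b - a) + a = n + b by omega]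
  have hF0 : ∀ i, (sm μ (l i)).totalVariation F = 0 := by
    intro i
    have h1 : F = limsup (fun n => E (n + (i + 1))) atTop := (limsup_nat_add E (i+1)).symm
    rw [h1]
    refine measure_limsup_atTop_eq_zero (ne_top_of_le_ne_top ?_
      (ENNReal.tsum_le_tsum (g := fun n => (2⁻¹ : ℝ≥0∞) ^ n) fun n => ?_))
    · rw [ENNReal.tsum_geometric]; simp
    · refine (hb i (n + (i+1)) (by omega)).trans (pow_le_pow_right_of_le_one' (by simp) (by omega))
  obtain ⟨m, hm⟩ := cont_empty μ (fun n => G n \ F) (fun a b hab => Set.sdiff_subset_sdiff_left (hGa hab))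
    (fun n => (hGm n).diff hFm) (by
      ext x
      simp only [Set.mem_iInter, Set.mem_sdiff, Set.mem_empty_iff_false, iff_false]
      intro h
      apply (h 0).2
      rw [hFG]
      exact Set.mem_iInter.2 fun n => (h n).1) hε
  have h1 := hm (E m \ F) ((hE m).diff hFm) (by
    refine Set.sdiff_subset_sdiff_left ?_
    exact fun x hx => Set.mem_iUnion.2 ⟨0, by simpa using hx⟩)
  have h3 : μ (E m ∩ F) + μ (E m \ F) = μ (E m) := by
    rw [← VectorMeasure.of_union (Set.disjoint_sdiff_right.mono_left Set.inter_subset_right)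
      ((hE m).inter hFm) ((hE m).diff hFm), Set.inter_union_sdiff]
  have h4 : l m (μ (E m ∩ F)) = 0 := by
    rw [← sm_apply]
    exact sm_zero_of_tv _ (measure_mono_null Set.inter_subset_right (hF0 m))
  obtain ⟨-, ha, hb', hc⟩ := hf m
  have h5 : l m (μ (E m)) = l m (μ (E m \ F)) := by rw [← h3, map_add, h4, zero_add]
  have h6 : l m (μ (E m \ F)) ≤ ‖μ (E m \ F)‖ := by
    refine (le_abs_self _).trans (((l m).le_opNorm _).trans ?_)
    exact mul_le_of_le_one_left (norm_nonneg _) ha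
  have h7 : l m (μ (E m)) = ‖μ (E m)‖ := hb'
  have h8 : ε ≤ ‖μ (E m)‖ := hc
  linarith

lemma exists_control (μ : VectorMeasure Ω X) :
    ∃ ν : Measure Ω, IsFiniteMeasure ν ∧ ∀ ε : ℝ, 0 < ε → ∃ δ : ℝ≥0∞, 0 < δ ∧
      ∀ E, MeasurableSet E → ν E < δ → ‖μ E‖ < ε := by
  choose S δ hδ hS using fun n : ℕ => exists_finset μ (ε := 1 / ((n : ℝ) + 1)) (by positivity)
  let κ : ℕ → Measure Ω := fun n => ∑ l ∈ S n, (sm μ l).totalVariation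
  have hκ : ∀ n, IsFiniteMeasure (κ n) := fun n => by
    simp only [κ]; infer_instance
  refine ⟨(Measure.sum κ).toFinite, inferInstance, fun ε hε => ?_⟩
  obtain ⟨n, hn⟩ := exists_nat_one_div_lt hε
  have hac : κ n ≪ (Measure.sum κ).toFinite :=
    (Measure.le_sum κ n).absolutelyContinuous.trans (absolutelyContinuous_toFinite _)
  obtain ⟨η, hη, h⟩ := exists_pos_setLIntegral_lt_of_measure_lt
    (μ := (Measure.sum κ).toFinite) (f := (κ n).rnDeriv (Measure.sum κ).toFinite)
    (Measure.lintegral_rnDeriv_lt_top _ _).ne (hδ n).ne'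
  refine ⟨η, hη, fun E hE hlt => (hS n E hE fun l hl => ?_).trans hn⟩
  have h1 := h E hlt
  rw [Measure.setLIntegral_rnDeriv hac] at h1
  refine lt_of_le_of_lt ?_ h1
  simp only [κ, Measure.coe_finsetSum, Finset.sum_apply]
  exact Finset.single_le_sum (f := fun l => (sm μ l).totalVariation E) (fun _ _ => by simp) hl
end

lemma hilbert_aux {H : Type*} [NormedAddCommGroup H] [InnerProductSpace ℝ H]
    (f : ℕ → H) (C : ℝ) (hC : ∀ n, ‖f n‖ ≤ C) :
    ∃ φ : ℕ → ℕ, StrictMono φ ∧ ∃ a : ℝ, ∀ i j, i ≠ j →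
      |inner ℝ (f (φ i)) (f (φ j)) - a| ≤ 2 * ((1/2) ^ i + (1/2) ^ j) := by
  have hC0 : 0 ≤ C := (norm_nonneg _).trans (hC 0)
  have hin : ∀ i j, inner ℝ (f i) (f j) ∈ Set.Icc (-(C*C)) (C*C) := fun i j => by
    rw [← abs_le.trans Set.mem_Icc.symm]
    exact (abs_real_inner_le_norm _ _).trans (mul_le_mul (hC i) (hC j) (norm_nonneg _) hC0)
  obtain ⟨α, hα, ψ, hψ, hlim⟩ :=
    (isCompact_univ_pi (fun _ : ℕ => isCompact_Icc (a := -(C*C)) (b := C*C))).tendsto_subseq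
      (x := fun m n => inner ℝ (f n) (f m)) (fun m n _ => hin n m)
  rw [tendsto_pi_nhds] at hlim
  obtain ⟨a, -, χ, hχ, hlim2⟩ := (isCompact_Icc (a := -(C*C)) (b := C*C)).tendsto_subseq
      (x := fun m => α (ψ m)) (fun m => hα _ trivial)
  obtain ⟨ρ, hρ, hρ'⟩ := extraction_forall_of_eventually
    (P := fun n k => |α (ψ (χ k)) - a| < (1/2 : ℝ) ^ n) (by
      intro n
      have := (Metric.tendsto_nhds.1 hlim2) ((1/2 : ℝ) ^ n) (by positivity)
      simpa [Real.dist_eq] using this)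
  let q : ℕ → ℕ := fun m => ψ (χ (ρ m))
  have hq : StrictMono q := hψ.comp (hχ.comp hρ)
  have hl : ∀ i, Tendsto (fun m => inner ℝ (f i) (f (q m))) atTop (𝓝 (α i)) := fun i =>
    (hlim i).comp (hχ.comp hρ).tendsto_atTop
  obtain ⟨θ, -, hθ⟩ := exists_seq_of_forall_finset_exists (α := ℕ) (fun _ => True)
    (fun m n => m < n ∧ |inner ℝ (f (q m)) (f (q n)) - α (q m)| < (1/2 : ℝ) ^ m) (by
      intro s _
      have : ∀ᶠ n in atTop, ∀ m ∈ s,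
          m < n ∧ |inner ℝ (f (q m)) (f (q n)) - α (q m)| < (1/2 : ℝ) ^ m := by
        rw [Filter.eventually_all_finset]
        intro m _
        refine (eventually_gt_atTop m).and ?_
        have := (Metric.tendsto_nhds.1 (hl (q m))) ((1/2 : ℝ) ^ m) (by positivity)
        simpa [Real.dist_eq] using this
      obtain ⟨n, hn⟩ := this.exists
      exact ⟨n, trivial, hn⟩)
  have hθm : StrictMono θ := fun a b hab => (hθ a b hab).1
  have key : ∀ i j, i < j →
      |inner ℝ (f (q (θ i))) (f (q (θ j))) - a| ≤ 2 * ((1/2) ^ i + (1/2) ^ j) := by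
    intro i j hij
    have h1 := (hθ i j hij).2
    have h2 := hρ' (θ i)
    have h3 : (1/2 : ℝ) ^ (θ i) ≤ (1/2) ^ i :=
      pow_le_pow_of_le_one (by norm_num) (by norm_num) (hθm.id_le i)
    have h4 : (0:ℝ) ≤ (1/2) ^ j := by positivity
    have h5 := abs_sub_le (inner ℝ (f (q (θ i))) (f (q (θ j)))) (α (q (θ i))) a
    have h6 : |α (q (θ i)) - a| < (1/2 : ℝ) ^ (θ i) := h2
    linarith
  refine ⟨fun i => q (θ i), hq.comp hθm, a, fun i j hij => ?_⟩
  rcases lt_or_gt_of_ne hij with h | h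
  · exact key i j h
  · have := key j i h
    rw [real_inner_comm, add_comm]
    rwa [real_inner_comm] at this ⊢

lemma hilbert_cesaro {H : Type*} [NormedAddCommGroup H] [InnerProductSpace ℝ H]
    (f : ℕ → H) (C : ℝ) (hC : ∀ n, ‖f n‖ ≤ C) :
    ∃ φ : ℕ → ℕ, StrictMono φ ∧
      CauchySeq (fun N : ℕ => (N : ℝ)⁻¹ • ∑ k ∈ Finset.range N, f (φ k)) := by
  obtain ⟨φ, hφ, a, ha⟩ := hilbert_aux f C hC
  refine ⟨φ, hφ, ?_⟩
  set s : ℕ → H := fun N => (N : ℝ)⁻¹ • ∑ k ∈ Finset.range N, f (φ k) with hs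
  let K : ℝ := C * C + |a|
  have hC0 : 0 ≤ C := (norm_nonneg _).trans (hC 0)
  have hK : 0 ≤ K := by positivity
  have e : ∀ i j, |inner ℝ (f (φ i)) (f (φ j)) - a| ≤
      2 * ((1/2) ^ i + (1/2) ^ j) + (if i = j then K else 0) := by
    intro i j
    by_cases h : i = j
    · rw [if_pos h]
      have h1 : |inner ℝ (f (φ i)) (f (φ j)) - a| ≤ K := by
        refine (abs_sub _ _).trans (add_le_add ?_ le_rfl)
        exact (abs_real_inner_le_norm _ _).trans (mul_le_mul (hC _) (hC _) (norm_nonneg _) hC0)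
      have : (0:ℝ) ≤ 2 * ((1/2) ^ i + (1/2) ^ j) := by positivity
      linarith
    · rw [if_neg h, add_zero]; exact ha i j h
  have geo : ∀ N : ℕ, ∑ i ∈ Finset.range N, (1/2 : ℝ) ^ i ≤ 2 := fun N => by
    have := sum_geometric_two_le N
    simpa using this
  have main : ∀ N M : ℕ, 0 < N → 0 < M →
      |inner ℝ (s N) (s M) - a| ≤ (4 + K) * ((N : ℝ)⁻¹ + (M : ℝ)⁻¹) := by
    intro N M hN hM
    have hN' : (0:ℝ) < N := by exact_mod_cast hN
    have hM' : (0:ℝ) < M := by exact_mod_cast hM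
    have h1 : inner ℝ (s N) (s M) - a = (N : ℝ)⁻¹ * (M : ℝ)⁻¹ *
        ∑ i ∈ Finset.range N, ∑ j ∈ Finset.range M, (inner ℝ (f (φ i)) (f (φ j)) - a) := by
      have h0 : inner ℝ (s N) (s M) = (N : ℝ)⁻¹ * ((M : ℝ)⁻¹ *
          ∑ i ∈ Finset.range N, ∑ j ∈ Finset.range M, inner ℝ (f (φ i)) (f (φ j))) := by
        simp only [hs]
        rw [real_inner_smul_left, real_inner_smul_right, sum_inner]
        simp_rw [inner_sum]
      simp only [h0, Finset.sum_sub_distrib, Finset.sum_const, Finset.card_range, nsmul_eq_mul]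
      generalize ∑ i ∈ Finset.range N, ∑ j ∈ Finset.range M, inner ℝ (f (φ i)) (f (φ j)) = T
      field_simp
    rw [h1, abs_mul, abs_of_pos (by positivity : (0:ℝ) < (N : ℝ)⁻¹ * (M : ℝ)⁻¹)]
    have h2 : |∑ i ∈ Finset.range N, ∑ j ∈ Finset.range M, (inner ℝ (f (φ i)) (f (φ j)) - a)| ≤
        ∑ i ∈ Finset.range N, ∑ j ∈ Finset.range M,
          (2 * ((1/2 : ℝ) ^ i + (1/2) ^ j) + (if i = j then K else 0)) := by
      refine (Finset.abs_sum_le_sum_abs _ _).trans (Finset.sum_le_sum fun i _ => ?_)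
      exact (Finset.abs_sum_le_sum_abs _ _).trans (Finset.sum_le_sum fun j _ => e i j)
    have h3 : ∑ i ∈ Finset.range N, ∑ j ∈ Finset.range M,
          (2 * ((1/2 : ℝ) ^ i + (1/2) ^ j) + (if i = j then K else 0)) ≤
          4 * M + 4 * N + K * N := by
      have h4 : ∀ i ∈ Finset.range N, ∑ j ∈ Finset.range M,
          (2 * ((1/2 : ℝ) ^ i + (1/2) ^ j) + (if i = j then K else 0)) ≤
          2 * M * (1/2 : ℝ) ^ i + 4 + K := by
        intro i _
        rw [Finset.sum_add_distrib, ← Finset.mul_sum, Finset.sum_add_distrib]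
        have h5 : ∑ j ∈ Finset.range M, (if i = j then K else 0) ≤ K := by
          rw [Finset.sum_ite_eq]; split_ifs <;> simp [hK]
        have h6 := geo M
        simp only [Finset.sum_const, Finset.card_range, nsmul_eq_mul] at *
        nlinarith
      refine (Finset.sum_le_sum h4).trans ?_
      rw [Finset.sum_add_distrib, Finset.sum_add_distrib, ← Finset.mul_sum]
      simp only [Finset.sum_const, Finset.card_range, nsmul_eq_mul]
      have h6 := geo N
      nlinarith
    have h7 : (N : ℝ)⁻¹ * (M : ℝ)⁻¹ * (4 * M + 4 * N + K * N) ≤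
        (4 + K) * ((N : ℝ)⁻¹ + (M : ℝ)⁻¹) := by
      have : (N : ℝ)⁻¹ * (M : ℝ)⁻¹ * (4 * M + 4 * N + K * N) =
        4 * (N : ℝ)⁻¹ + (4 + K) * (M : ℝ)⁻¹ := by field_simp; ring
      rw [this]
      have : 0 ≤ K * (N : ℝ)⁻¹ := by positivity
      linarith
    exact (mul_le_mul_of_nonneg_left (h2.trans h3) (by positivity)).trans h7
  have dist2 : ∀ N M : ℕ, 0 < N → 0 < M →
      ‖s N - s M‖ ^ 2 ≤ 4 * (4 + K) * ((N : ℝ)⁻¹ + (M : ℝ)⁻¹) := by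
    intro N M hN hM
    rw [norm_sub_sq_real, ← real_inner_self_eq_norm_sq, ← real_inner_self_eq_norm_sq]
    have h1 := abs_le.1 (main N N hN hN)
    have h2 := abs_le.1 (main N M hN hM)
    have h3 := abs_le.1 (main M M hM hM)
    nlinarith [h1.2, h2.1, h3.2]
  rw [Metric.cauchySeq_iff]
  intro ε hε
  have ht : Tendsto (fun N : ℕ => 8 * (4 + K) * (N : ℝ)⁻¹) atTop (𝓝 0) := by
    simpa using (tendsto_inv_atTop_nhds_zero_nat (𝕜 := ℝ)).const_mul (8 * (4 + K))
  obtain ⟨N0, hN0, hpos⟩ := ((ht.eventually_lt_const (show 0 < ε ^ 2 by positivity)).and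
    (eventually_gt_atTop 0)).exists
  refine ⟨N0, fun N hN M hM => ?_⟩
  rw [dist_eq_norm]
  have h0 : (0:ℝ) < N0 := by exact_mod_cast hpos
  have h1 : (N : ℝ)⁻¹ ≤ (N0 : ℝ)⁻¹ := inv_anti₀ h0 (by exact_mod_cast hN)
  have h2 : (M : ℝ)⁻¹ ≤ (N0 : ℝ)⁻¹ := inv_anti₀ h0 (by exact_mod_cast hM)
  have h3 := dist2 N M (by omega) (by omega)
  refine lt_of_pow_lt_pow_left₀ 2 hε.le (h3.trans_lt (lt_of_le_of_lt ?_ hN0))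
  nlinarith

section
variable {X Ω : Type*} [NormedAddCommGroup X] [NormedSpace ℝ X] [MeasurableSpace Ω]

/-- `x` is (weakly) the integral of the bounded measurable function `g` against `μ`. -/
def Rep (μ : VectorMeasure Ω X) (x : X) (g : Ω → ℝ) : Prop :=
  Measurable g ∧ (∃ C, ∀ w, ‖g w‖ ≤ C) ∧ ∀ l : StrongDual ℝ X,
    l x = ∫ w, g w ∂(sm μ l).toJordanDecomposition.posPart
      - ∫ w, g w ∂(sm μ l).toJordanDecomposition.negPart

lemma Rep.integrable {μ : VectorMeasure Ω X} {x : X} {g : Ω → ℝ} (h : Rep μ x g)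
    (ν : Measure Ω) [IsFiniteMeasure ν] : Integrable g ν := by
  obtain ⟨hm, ⟨C, hC⟩, -⟩ := h
  exact Integrable.of_bound hm.aestronglyMeasurable C (Eventually.of_forall hC)

lemma Rep.memLp {μ : VectorMeasure Ω X} {x : X} {g : Ω → ℝ} (h : Rep μ x g)
    (ν : Measure Ω) [IsFiniteMeasure ν] : MemLp g 2 ν := by
  obtain ⟨hm, ⟨C, hC⟩, -⟩ := h
  exact MemLp.of_bound hm.aestronglyMeasurable C (Eventually.of_forall hC)

lemma Rep.zero (μ : VectorMeasure Ω X) : Rep μ 0 0 :=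
  ⟨measurable_const, ⟨0, by simp⟩, fun l => by simp⟩

lemma Rep.add {μ : VectorMeasure Ω X} {x y : X} {g h : Ω → ℝ} (hx : Rep μ x g)
    (hy : Rep μ y h) : Rep μ (x + y) (g + h) := by
  obtain ⟨C, hC⟩ := hx.2.1
  obtain ⟨D, hD⟩ := hy.2.1
  refine ⟨hx.1.add hy.1, ⟨C + D, fun w => (norm_add_le _ _).trans (add_le_add (hC w) (hD w))⟩,
    fun l => ?_⟩
  simp only [Pi.add_apply]
  rw [integral_add (hx.integrable _) (hy.integrable _), integral_add (hx.integrable _)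
    (hy.integrable _), map_add, hx.2.2 l, hy.2.2 l]
  ring

lemma Rep.smul {μ : VectorMeasure Ω X} {x : X} {g : Ω → ℝ} (c : ℝ) (hx : Rep μ x g) :
    Rep μ (c • x) (c • g) := by
  obtain ⟨C, hC⟩ := hx.2.1
  refine ⟨hx.1.const_smul c, ⟨‖c‖ * C, fun w => ?_⟩, fun l => ?_⟩
  · rw [Pi.smul_apply, norm_smul]
    exact mul_le_mul_of_nonneg_left (hC w) (norm_nonneg _)
  · simp only [Pi.smul_apply]
    rw [integral_smul, integral_smul, map_smul, hx.2.2 l]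
    simp only [smul_eq_mul]
    ring

lemma Rep.sub {μ : VectorMeasure Ω X} {x y : X} {g h : Ω → ℝ} (hx : Rep μ x g)
    (hy : Rep μ y h) : Rep μ (x - y) (g - h) := by
  have := hx.add (hy.smul (-1))
  simpa [sub_eq_add_neg] using this

lemma Rep.sum {μ : VectorMeasure Ω X} {x : ℕ → X} {g : ℕ → Ω → ℝ} (h : ∀ n, Rep μ (x n) (g n))
    (N : ℕ) : Rep μ (∑ k ∈ Finset.range N, x k) (∑ k ∈ Finset.range N, g k) := by
  induction N with
  | zero => simpa using Rep.zero μ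
  | succ N ih => rw [Finset.sum_range_succ, Finset.sum_range_succ]; exact ih.add (h N)

lemma Rep.indicator (μ : VectorMeasure Ω X) {E : Set Ω} (hE : MeasurableSet E) :
    Rep μ (μ E) (E.indicator 1) := by
  refine ⟨measurable_one.indicator hE, ⟨1, fun w => ?_⟩, fun l => ?_⟩
  · by_cases h : w ∈ E <;> simp [h]
  · rw [integral_indicator_one hE, integral_indicator_one hE, ← sm_apply]
    exact (sm μ l).apply_eq_posPart_real_sub_negPart_real hE

lemma exists_rep (μ : VectorMeasure Ω X) {x : X} (hx : x ∈ convexHull ℝ (Set.range μ)) :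
    ∃ g, Rep μ x g ∧ ∀ w, 0 ≤ g w ∧ g w ≤ 1 := by
  have : convexHull ℝ (Set.range μ) ⊆ {x | ∃ g, Rep μ x g ∧ ∀ w, 0 ≤ g w ∧ g w ≤ 1} := by
    refine convexHull_min ?_ ?_
    · rintro _ ⟨E, rfl⟩
      by_cases hE : MeasurableSet E
      · refine ⟨_, Rep.indicator μ hE, fun w => ?_⟩
        by_cases h : w ∈ E <;> simp [h]
      · rw [μ.not_measurable hE]
        exact ⟨0, Rep.zero μ, fun w => by simp⟩
    · rintro x ⟨g, hg, hg'⟩ y ⟨h, hh, hh'⟩ a b ha hb hab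
      refine ⟨_, (hg.smul a).add (hh.smul b), fun w => ?_⟩
      simp only [Pi.add_apply, Pi.smul_apply, smul_eq_mul]
      obtain ⟨h1, h2⟩ := hg' w
      obtain ⟨h3, h4⟩ := hh' w
      constructor
      · positivity
      · nlinarith
  exact this hx

lemma Rep.norm_le {μ : VectorMeasure Ω X} {x : X} {g : Ω → ℝ} (h : Rep μ x g)
    (hg : ∀ w, |g w| ≤ 1) {ε r : ℝ} (hε : 0 ≤ ε)
    (hr : ∀ B, MeasurableSet B → B ⊆ {w | ε ≤ |g w|} → ‖μ B‖ ≤ r) :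
    ‖x‖ ≤ ε * (2 * μ.bound) + 2 * r := by
  obtain ⟨l, hl, hlx⟩ := exists_dual_vector'' ℝ x
  have hlx' : ‖x‖ = l x := by simpa using hlx.symm
  let E : Set Ω := {w | ε ≤ |g w|}
  have hE : MeasurableSet E := measurableSet_le measurable_const h.1.abs
  have hle : ∀ B, |sm μ l B| ≤ ‖μ B‖ := fun B => by
    rw [sm_apply]
    exact (l.le_opNorm _).trans (mul_le_of_le_one_left (norm_nonneg _) hl)
  have h1 : (sm μ l).totalVariation.real E ≤ 2 * r :=
    tv_real_le _ hE fun B hB hBE => (hle B).trans (hr B hB hBE)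
  have h2 : (sm μ l).totalVariation.real Set.univ ≤ 2 * μ.bound :=
    tv_real_le _ MeasurableSet.univ fun B hB _ => (hle B).trans VectorMeasure.norm_apply_le_bound
  have h3 : l x ≤ ∫ w, |g w| ∂(sm μ l).totalVariation := by
    rw [SignedMeasure.totalVariation, integral_add_measure (h.integrable _).abs
      (h.integrable _).abs, h.2.2 l]
    have ha := (abs_le.1 (abs_integral_le_integral_abs (f := g)
      (μ := (sm μ l).toJordanDecomposition.posPart))).2
    have hb := (abs_le.1 (abs_integral_le_integral_abs (f := g)
      (μ := (sm μ l).toJordanDecomposition.negPart))).1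
    linarith
  have h4 : ∫ w, |g w| ∂(sm μ l).totalVariation ≤
      ∫ w, (ε + E.indicator 1 w) ∂(sm μ l).totalVariation := by
    refine integral_mono (h.integrable _).abs ((integrable_const _).add
      ((integrable_const (1:ℝ)).indicator hE)) fun w => ?_
    by_cases hw : w ∈ E
    · have := hg w
      simp only [Set.indicator_of_mem hw, Pi.one_apply]; linarith
    · simp only [Set.indicator_of_notMem hw]
      have : |g w| < ε := not_le.1 hw
      linarith
  have hi : Integrable (E.indicator (1 : Ω → ℝ)) (sm μ l).totalVariation :=
    (integrable_const (1:ℝ)).indicator hE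
  rw [integral_add (integrable_const _) hi, integral_indicator_one hE, integral_const, smul_eq_mul] at h4
  have h5 := mul_le_mul_of_nonneg_left h2 hε
  rw [hlx']
  linarith

lemma toLp_sum {ν : Measure Ω} (f : ℕ → Ω → ℝ) (hf : ∀ n, MemLp (f n) 2 ν) (N : ℕ) :
    ∀ h : MemLp (∑ k ∈ Finset.range N, f k) 2 ν,
      h.toLp _ = ∑ k ∈ Finset.range N, (hf k).toLp (f k) := by
  induction N with
  | zero => intro h; simp only [Finset.range_zero, Finset.sum_empty]; exact MemLp.toLp_zero _
  | succ N ih =>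
    intro h
    have h1 : MemLp (∑ k ∈ Finset.range N, f k) 2 ν := memLp_finsetSum' _ fun k _ => hf k
    rw [Finset.sum_range_succ (fun k => (hf k).toLp (f k)), ← ih h1, ← MemLp.toLp_add]
    exact MemLp.toLp_congr _ _ (by rw [Finset.sum_range_succ])

end
end BSaux

open BSaux

/-- If a Banach-Saks subset `A` of a Banach space `X` is contained in the range of a countably
additive `X`-valued vector measure, then `conv A` is also a Banach-Saks set. -/
theorem convexHull_banachSaks_of_range_vectorMeasure {X : Type*} [NormedAddCommGroup X]
    [NormedSpace ℝ X] [CompleteSpace X] {Ω : Type*} [MeasurableSpace Ω]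
    (μ : VectorMeasure Ω X) (A : Set X) (hA : IsBanachSaksSet A)
    (hrange : A ⊆ Set.range (⇑μ)) :
    IsBanachSaksSet (convexHull ℝ A) := by
  classical
  intro x hx
  have hx' : ∀ n, ∃ g, Rep μ (x n) g ∧ ∀ w, 0 ≤ g w ∧ g w ≤ 1 := fun n =>
    exists_rep μ (convexHull_mono hrange (hx n))
  choose g hg hg1 using hx'
  obtain ⟨ν, hν, hctl⟩ := exists_control μ
  have hmem : ∀ n, MemLp (g n) 2 ν := fun n => (hg n).memLp ν
  obtain ⟨C, hC⟩ : ∃ C, ∀ n, ‖(hmem n).toLp (g n)‖ ≤ C := by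
    refine ⟨(ν Set.univ).toReal ^ ((2 : ENNReal).toReal⁻¹) * 1, fun n => ?_⟩
    refine Lp.norm_le_of_ae_bound zero_le_one ?_
    filter_upwards [(hmem n).coeFn_toLp] with w hw
    rw [hw, Real.norm_eq_abs, abs_le]
    constructor <;> linarith [(hg1 n w).1, (hg1 n w).2]
  obtain ⟨φ, hφ, hcau⟩ := hilbert_cesaro (fun n => (hmem n).toLp (g n)) C hC
  refine ⟨φ, hφ, ?_⟩
  set y : ℕ → X := fun N => (N : ℝ)⁻¹ • ∑ k ∈ Finset.range N, x (φ k) with hy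
  let G : ℕ → Ω → ℝ := fun N => (N : ℝ)⁻¹ • ∑ k ∈ Finset.range N, g (φ k)
  have hG : ∀ N, Rep μ (y N) (G N) := fun N => (Rep.sum (fun k => hg (φ k)) N).smul _
  have hG1 : ∀ N w, 0 ≤ G N w ∧ G N w ≤ 1 := by
    intro N w
    simp only [G, Pi.smul_apply, Finset.sum_apply, smul_eq_mul]
    have h0 : 0 ≤ ∑ k ∈ Finset.range N, g (φ k) w := Finset.sum_nonneg fun k _ => (hg1 _ w).1
    have h1 : ∑ k ∈ Finset.range N, g (φ k) w ≤ N := by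
      refine (Finset.sum_le_sum fun k _ => (hg1 (φ k) w).2).trans ?_
      simp
    refine ⟨by positivity, ?_⟩
    rcases Nat.eq_zero_or_pos N with rfl | hN
    · simp
    · have : (0:ℝ) < N := by exact_mod_cast hN
      rw [inv_mul_le_iff₀ this]; linarith
  have hGL : ∀ N, ((hG N).memLp ν).toLp (G N) =
      (N : ℝ)⁻¹ • ∑ k ∈ Finset.range N, (hmem (φ k)).toLp (g (φ k)) := by
    intro N
    have h1 : MemLp (∑ k ∈ Finset.range N, g (φ k)) 2 ν :=
      memLp_finsetSum' _ fun k _ => hmem (φ k)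
    rw [← toLp_sum (fun k => g (φ k)) (fun k => hmem (φ k)) N h1, ← MemLp.toLp_const_smul]
  have hcau' : CauchySeq (fun N => ((hG N).memLp ν).toLp (G N)) := by
    simp_rw [hGL]; exact hcau
  have ht : Tendsto (fun p : ℕ × ℕ => eLpNorm ((G p.1 - G p.2) - 0) 2 ν) atTop (nhds 0) := by
    have h1 : Tendsto (fun p : ℕ × ℕ => edist (((hG p.1).memLp ν).toLp (G p.1))
        (((hG p.2).memLp ν).toLp (G p.2))) atTop (nhds 0) := by
      have := cauchySeq_iff_tendsto.1 hcau'
      have h2 := ENNReal.tendsto_ofReal (tendsto_uniformity_iff_dist_tendsto_zero.1 this)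
      rw [ENNReal.ofReal_zero] at h2
      refine h2.congr fun p => ?_
      rw [edist_dist]
      rfl
    refine h1.congr fun p => ?_
    rw [Lp.edist_toLp_toLp, sub_zero]
  have htm : TendstoInMeasure ν (fun p : ℕ × ℕ => G p.1 - G p.2) atTop 0 :=
    tendstoInMeasure_of_tendsto_eLpNorm (by norm_num)
      (fun p => ((hG p.1).sub (hG p.2)).1.aestronglyMeasurable) aestronglyMeasurable_zero ht
  rw [tendstoInMeasure_iff_norm] at htm
  have hyc : CauchySeq y := by
    rw [cauchySeq_iff_tendsto, tendsto_uniformity_iff_dist_tendsto_zero]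
    rw [Metric.tendsto_nhds]
    intro ε hε
    have hK : (0:ℝ) ≤ μ.bound := μ.bound.coe_nonneg
    obtain ⟨δ, hδ, hd⟩ := hctl (ε / 8) (by positivity)
    have hη : 0 < ε / (8 * (μ.bound + 1)) := by positivity
    filter_upwards [(htm _ hη).eventually_lt_const hδ] with p hp
    have h1 := ((hG p.1).sub (hG p.2)).norm_le (ε := ε / (8 * (μ.bound + 1))) (r := ε / 8)
      (fun w => by
        have h1 := hG1 p.1 w
        have h2 := hG1 p.2 w
        rw [Pi.sub_apply, abs_le]
        constructor <;> linarith [h1.1, h1.2, h2.1, h2.2]) hη.le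
      (fun B hB hBs => (hd B hB (lt_of_le_of_lt (measure_mono (by simpa using hBs)) hp)).le)
    have h2 : ε / (8 * (μ.bound + 1)) * (2 * μ.bound) ≤ ε / 4 := by
      rw [div_mul_eq_mul_div, div_le_iff₀ (by positivity)]
      nlinarith
    simp only [sub_zero, norm_norm, Prod.map_fst, Prod.map_snd, dist_eq_norm]
    linarith
  exact cauchySeq_tendsto_of_complete hyc
end
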